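/- Let V be a complex Hilbert space with Hilbert basis (e_j), and for v ∈ V define ι(v) = ‖v‖·P_v, where P_v is the orthogonal projection onto ℂv (and ι(0) = 0). Then for all vectors v₁, …, v_k ∈ V, not all zero, one has 2·(‖Σᵢ vᵢ‖² / (k·Σᵢ ‖vᵢ‖²)) − 1 ≤ (Σ_j ‖Σᵢ ι(vᵢ)(e_j)‖²) / (k·Σᵢ ‖vᵢ‖²); that is, 2·codist(v₁, …, v_k) − 1 ≤ codist(ι(v₁), …, ι(v_k)), where for vectors u₁, …, u_k of a Hilbert space codist(u₁, …, u_k) = ‖Σuᵢ‖² / (k·Σ‖uᵢ‖²), and the operators ι(vᵢ) are measured in the Hilbert–Schmidt norm (note ‖ι(v)‖_{HS} = ‖v‖). -/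

import Mathlib

/-- Lemma 9.2: let `V` be a complex Hilbert space with Hilbert basis `(e_j)`,
`P w` the orthogonal projection onto `ℂw` for `w ≠ 0` (characterized by
`P w x ∈ ℂw` and `x - P w x ⟂ ℂw`), and `ι(w) = ‖w‖·P_w` (with `ι(0) = 0`).
Then for vectors `v₁, …, v_k`, not all zero,
`2·codist(v₁, …, v_k) - 1 ≤ codist(ι(v₁), …, ι(v_k))`, where
`codist(u₁, …, u_k) = ‖Σuᵢ‖²/(k·Σ‖uᵢ‖²)` and the operators `ι(vᵢ)` are measured
in the Hilbert–Schmidt norm `‖T‖² = Σ_j ‖T(e_j)‖²` (so `‖ι(v)‖ = ‖v‖`). -/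
theorem statement19 {V : Type*} [NormedAddCommGroup V] [InnerProductSpace ℂ V]
    [CompleteSpace V]
    {ι : Type*} (e : HilbertBasis ι ℂ V)
    (P : V → V → V)
    (hP : ∀ w : V, w ≠ 0 →
      ∀ x : V, P w x ∈ Submodule.span ℂ {w} ∧ x - P w x ∈ (Submodule.span ℂ {w})ᗮ)
    (iot : V → V → V)
    (hiot0 : ∀ x : V, iot 0 x = 0)
    (hiot : ∀ w : V, w ≠ 0 → ∀ x : V, iot w x = ‖w‖ • P w x)
    (k : ℕ) (v : Fin k → V) (hv : ∃ i, v i ≠ 0) :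
    2 * (‖∑ i, v i‖ ^ 2 / (k * ∑ i, ‖v i‖ ^ 2)) - 1 ≤
      (∑' j, ‖∑ i, iot (v i) (e j)‖ ^ 2) / (k * ∑ i, ‖v i‖ ^ 2) := by
  have hform : ∀ w x : V, iot w x = (((‖w‖⁻¹ : ℝ) : ℂ) * inner ℂ w x) • w := by
    intro w x
    by_cases hw : w = 0
    · subst hw; simp [hiot0]
    · obtain ⟨h1, h2⟩ := hP w hw x
      obtain ⟨c, hc⟩ := Submodule.mem_span_singleton.1 h1
      have h3 : inner ℂ w (x - P w x) = 0 :=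
        (Submodule.mem_orthogonal _ _).1 h2 w (Submodule.mem_span_singleton_self w)
      rw [← hc, inner_sub_right, inner_smul_right, inner_self_eq_norm_sq_to_K, sub_eq_zero] at h3
      rw [hiot w hw x, ← hc, h3, RCLike.real_smul_eq_coe_smul (K := ℂ), smul_smul]
      congr 1
      have : (‖w‖ : ℂ) ≠ 0 := by simpa using hw
      simp only [Complex.coe_algebraMap, Complex.ofReal_inv]
      field_simp
  have hpair : ∀ a b : V, HasSum (fun j => (inner ℂ (iot a (e j)) (iot b (e j)) : ℂ).re)
      (‖a‖⁻¹ * ‖b‖⁻¹ * ‖(inner ℂ a b : ℂ)‖ ^ 2) := by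
    intro a b
    have h := (e.hasSum_inner_mul_inner b a).mul_left
      ((((‖a‖⁻¹ * ‖b‖⁻¹ : ℝ) : ℂ)) * inner ℂ a b)
    have h' := Complex.hasSum_re h
    convert h' using 1
    · funext j
      congr 1
      rw [hform, hform, inner_smul_left, inner_smul_right, map_mul, inner_conj_symm,
        Complex.conj_ofReal]
      push_cast
      ring
    · rw [mul_assoc (Complex.ofReal _), ← inner_conj_symm b a, Complex.mul_conj, Complex.normSq_eq_norm_sq,
        ← Complex.ofReal_mul, Complex.ofReal_re]
  have hexp : ∀ u : Fin k → V, ‖∑ i, u i‖ ^ 2 = ∑ i, ∑ l, (inner ℂ (u i) (u l) : ℂ).re := by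
    intro u
    rw [← inner_self_eq_norm_sq (𝕜 := ℂ), sum_inner]
    simp [inner_sum]
  have hsum : HasSum (fun j => ‖∑ i, iot (v i) (e j)‖ ^ 2)
      (∑ i, ∑ l, ‖v i‖⁻¹ * ‖v l‖⁻¹ * ‖(inner ℂ (v i) (v l) : ℂ)‖ ^ 2) := by
    simp_rw [hexp]
    exact hasSum_sum fun i _ => hasSum_sum fun l _ => hpair (v i) (v l)
  have hkey : ∀ a b : V, 2 * (inner ℂ a b : ℂ).re - ‖a‖ * ‖b‖ ≤
      ‖a‖⁻¹ * ‖b‖⁻¹ * ‖(inner ℂ a b : ℂ)‖ ^ 2 := by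
    intro a b
    by_cases ha : a = 0
    · subst ha; simp
    by_cases hb : b = 0
    · subst hb; simp
    have h1 := Complex.re_le_norm (inner ℂ a b : ℂ)
    have hpos : 0 < ‖a‖ * ‖b‖ := mul_pos (norm_pos_iff.2 ha) (norm_pos_iff.2 hb)
    rw [← mul_inv, inv_mul_eq_div, le_div_iff₀ hpos]
    nlinarith [sq_nonneg (‖(inner ℂ a b : ℂ)‖ - ‖a‖ * ‖b‖)]
  have hcs : ∑ i, ∑ l, ‖v i‖ * ‖v l‖ ≤ k * ∑ i, ‖v i‖ ^ 2 := by
    have := sq_sum_le_card_mul_sum_sq (s := Finset.univ) (f := fun i => ‖v i‖)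
    rw [Finset.card_univ, Fintype.card_fin, sq, Finset.sum_mul_sum] at this
    exact this
  have hD : 0 < (k : ℝ) * ∑ i, ‖v i‖ ^ 2 := by
    obtain ⟨i, hi⟩ := hv
    have hk : 0 < k := i.pos
    refine mul_pos (by exact_mod_cast hk) ?_
    exact Finset.sum_pos' (fun _ _ => by positivity)
      ⟨i, Finset.mem_univ _, pow_pos (norm_pos_iff.2 hi) 2⟩
  have hall : ∑ i, ∑ l, (2 * (inner ℂ (v i) (v l) : ℂ).re - ‖v i‖ * ‖v l‖) ≤
      ∑ i, ∑ l, ‖v i‖⁻¹ * ‖v l‖⁻¹ * ‖(inner ℂ (v i) (v l) : ℂ)‖ ^ 2 :=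
    Finset.sum_le_sum fun i _ => Finset.sum_le_sum fun l _ => hkey _ _
  simp only [Finset.sum_sub_distrib, ← Finset.mul_sum] at hall hcs
  rw [hsum.tsum_eq, le_div_iff₀ hD, hexp v, sub_mul, mul_assoc, div_mul_cancel₀ _ hD.ne']
  linarith
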